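/- arXiv:math/0609783 — 3 statements merged into one kernel-verified Lean document; each statement's English description precedes it below -/
import Mathlib

section
/- For every d ≥ 1, the group GL_d(ℚ) of invertible d×d rational matrices is generated as a group by the subgroup GL_d(ℤ) (matrices with integer entries whose inverses also have integer entries) together with all diagonal matrices diag(1, …, 1, n, 1, …, 1), where n ∈ ℕ is nonzero and occupies an arbitrary diagonal position. -/
open Matrix in
/-- A transvection is obtained from any nonzero rescaling of it by conjugating with a diagonal
matrix. -/
theorem Matrix.diagonal_mul_transvection_mul_diagonal {ι K : Type*} [Fintype ι] [DecidableEq ι]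
    [Field K] {i j : ι} (hij : i ≠ j) (a : K) {b : K} (hb : b ≠ 0) :
    diagonal (fun k => if k = i then b⁻¹ else 1) * transvection i j a *
      diagonal (fun k => if k = i then b else 1) = transvection i j (a / b) := by
  ext k l
  simp only [transvection, mul_diagonal, diagonal_mul, add_apply, one_apply, single_apply]
  grind

/-- A submonoid of matrices over a field that contains all diagonal matrices with a single nonzero
entry possibly different from `1` contains all diagonal matrices with nonzero entries. -/
theorem Matrix.diagonal_mem_of_forall_single {ι K : Type*} [Fintype ι] [DecidableEq ι] [Field K]
    (S : Submonoid (Matrix ι ι K))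
    (hS : ∀ (p : ι) (q : K), q ≠ 0 → Matrix.diagonal (fun i => if i = p then q else 1) ∈ S)
    (D : ι → K) (hD : ∀ i, D i ≠ 0) : Matrix.diagonal D ∈ S := by
  suffices h : ∀ s : Finset ι, Matrix.diagonal (fun i => if i ∈ s then D i else 1) ∈ S by
    simpa using h Finset.univ
  intro s
  induction s using Finset.induction_on with
  | empty => simp [S.one_mem]
  | insert p s hp ih =>
    convert S.mul_mem (hS p (D p) (hD p)) ih using 1
    rw [Matrix.diagonal_mul_diagonal]
    congr 1
    ext i
    by_cases hi : i = p
    · subst hi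
      simp [hp]
    · simp [hi]


theorem glQ_generated_by_glZ_and_diagonal (d : ℕ) (hd : 1 ≤ d) :
    Subgroup.closure
      ({A : (Matrix (Fin d) (Fin d) ℚ)ˣ |
          (∀ i j, ∃ k : ℤ, (A : Matrix (Fin d) (Fin d) ℚ) i j = (k : ℚ)) ∧
          (∀ i j, ∃ k : ℤ,
            ((A⁻¹ : (Matrix (Fin d) (Fin d) ℚ)ˣ) : Matrix (Fin d) (Fin d) ℚ) i j = (k : ℚ))} ∪
        {A : (Matrix (Fin d) (Fin d) ℚ)ˣ |
          ∃ (p : Fin d) (n : ℕ), n ≠ 0 ∧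
            (A : Matrix (Fin d) (Fin d) ℚ) =
              Matrix.diagonal fun i => if i = p then (n : ℚ) else 1}) = ⊤ := by
  set G : Subgroup (Matrix (Fin d) (Fin d) ℚ)ˣ := Subgroup.closure (_ ∪ _)
  let S : Submonoid (Matrix (Fin d) (Fin d) ℚ) := G.toSubmonoid.map (Units.coeHom _)
  have mem_inv {M N : Matrix (Fin d) (Fin d) ℚ} (hM : M ∈ S) (h : M * N = 1) : N ∈ S := by
    obtain ⟨A, hA, rfl⟩ := hM
    exact ⟨A⁻¹, G.inv_mem hA, (Units.eq_inv_of_mul_eq_one_left h).symm⟩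
  have mem_int (M N : Matrix (Fin d) (Fin d) ℚ) (h : M * N = 1)
      (hM : ∀ i j, ∃ k : ℤ, M i j = k) (hN : ∀ i j, ∃ k : ℤ, N i j = k) : M ∈ S :=
    ⟨⟨M, N, h, mul_eq_one_comm.mp h⟩, Subgroup.subset_closure (Or.inl ⟨hM, hN⟩), rfl⟩
  have single_mul (p : Fin d) (a b : ℚ) :
      (Matrix.diagonal fun i => if i = p then a else 1) *
        (Matrix.diagonal fun i => if i = p then b else 1) =
      Matrix.diagonal fun i => if i = p then a * b else 1 := by
    rw [Matrix.diagonal_mul_diagonal]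
    congr 1
    ext i
    split_ifs <;> simp
  have single_inv (p : Fin d) (a b : ℚ) (h : a * b = 1) :
      (Matrix.diagonal fun i => if i = p then a else 1) *
        (Matrix.diagonal fun i => if i = p then b else 1) = 1 := by
    rw [single_mul, h]
    simp
  have mem_nat (p : Fin d) (n : ℕ) (hn : n ≠ 0) :
      (Matrix.diagonal fun i => if i = p then (n : ℚ) else 1) ∈ S := by
    have hn' : (n : ℚ) * (n : ℚ)⁻¹ = 1 := mul_inv_cancel₀ (Nat.cast_ne_zero.mpr hn)
    have h := single_inv p _ _ hn'
    exact ⟨⟨_, _, h, mul_eq_one_comm.mp h⟩,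
      Subgroup.subset_closure (Or.inr ⟨p, n, hn, rfl⟩), rfl⟩
  have mem_neg_one (p : Fin d) :
      (Matrix.diagonal fun i => if i = p then (-1 : ℚ) else 1) ∈ S := by
    have h : ∀ i j, ∃ k : ℤ,
        (Matrix.diagonal fun i => if i = p then (-1 : ℚ) else 1) i j = k := fun i j =>
      ⟨Matrix.diagonal (fun i => if i = p then (-1 : ℤ) else 1) i j, by
        simp only [Matrix.diagonal_apply]
        split_ifs <;> simp⟩
    exact mem_int _ _ (single_inv p (-1) (-1) (by norm_num)) h h
  have mem_single (p : Fin d) (q : ℚ) (hq : q ≠ 0) :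
      (Matrix.diagonal fun i => if i = p then q else 1) ∈ S := by
    have hden : (q.den : ℚ) * (q.den : ℚ)⁻¹ = 1 :=
      mul_inv_cancel₀ (Nat.cast_ne_zero.mpr q.den_nz)
    have h := S.mul_mem (mem_nat p _ (Int.natAbs_ne_zero.mpr (Rat.num_ne_zero.mpr hq)))
      (mem_inv (mem_nat p _ q.den_nz) (single_inv p _ _ hden))
    rw [single_mul] at h
    have hq' : q = q.num * (q.den : ℚ)⁻¹ := by rw [← div_eq_mul_inv, Rat.num_div_den]
    rcases Int.natAbs_eq q.num with hs | hs
    · rw [hs, Int.cast_natCast] at hq'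
      rwa [← hq'] at h
    · rw [hs, Int.cast_neg, Int.cast_natCast, neg_mul, ← neg_one_mul] at hq'
      have h' := S.mul_mem (mem_neg_one p) h
      rwa [single_mul, ← hq'] at h'
  have mem_transvection_int (i j : Fin d) (hij : i ≠ j) (a : ℤ) :
      Matrix.transvection i j (a : ℚ) ∈ S := by
    have h (b : ℤ) (k l : Fin d) : ∃ c : ℤ, Matrix.transvection i j (b : ℚ) k l = c :=
      ⟨Matrix.transvection i j b k l, by
        simp only [Matrix.transvection, Matrix.add_apply, Matrix.one_apply, Matrix.single_apply]
        split_ifs <;> simp⟩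
    refine mem_int _ _ ?_ (h a) (h (-a))
    rw [Matrix.transvection_mul_transvection_same _ _ hij]
    simp
  have mem_all (M : Matrix (Fin d) (Fin d) ℚ) (hM : M.det ≠ 0) : M ∈ S := by
    refine Matrix.diagonal_transvection_induction_of_det_ne_zero (· ∈ S) M hM ?_ ?_
      fun _ _ _ _ => S.mul_mem
    · intro D hD
      rw [Matrix.det_diagonal, Finset.prod_ne_zero_iff] at hD
      exact Matrix.diagonal_mem_of_forall_single S mem_single D fun i => hD i (Finset.mem_univ i)
    · rintro ⟨i, j, hij, c⟩
      have hden : (c.den : ℚ) ≠ 0 := Nat.cast_ne_zero.mpr c.den_nz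
      have h := S.mul_mem (S.mul_mem (mem_single i _ (inv_ne_zero hden))
        (mem_transvection_int i j hij c.num)) (mem_single i _ hden)
      rwa [Matrix.diagonal_mul_transvection_mul_diagonal hij _ hden, Rat.num_div_den] at h
  refine (Subgroup.eq_top_iff' G).mpr fun A => ?_
  obtain ⟨B, hB, hBA⟩ := mem_all A ((Matrix.isUnit_iff_isUnit_det _).mp A.isUnit).ne_zero
  rwa [← Units.ext hBA]
end

section
/- Let G₁ and G₂ be finitely generated free abelian groups of the same rank, and let f₁ : G₁ → ℝ and f₂ : G₂ → ℝ be group homomorphisms into the additive group of ℝ with f₁(G₁) = f₂(G₂). Then there exists a group isomorphism g : G₁ → G₂ such that f₂ ∘ g = f₁. -/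
/-- A surjection onto a projective module identifies its source with the product of its kernel
and its target, the surjection becoming the second projection. -/
theorem LinearMap.exists_equiv_ker_prod_of_surjective {R M P : Type*} [Ring R]
    [AddCommGroup M] [Module R M] [AddCommGroup P] [Module R P] [Module.Projective R P]
    (p : M →ₗ[R] P) (hp : Function.Surjective p) :
    ∃ e : M ≃ₗ[R] p.ker × P, ∀ x, (e x).2 = p x := by
  obtain ⟨s, hs⟩ := p.exists_rightInverse_of_surjective (LinearMap.range_eq_top.2 hp)
  obtain ⟨e, -, he⟩ := (LinearMap.exact_subtype_ker_map p).splitSurjectiveEquiv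
    p.ker.injective_subtype ⟨s, hs⟩
  exact ⟨e, fun x => by simp [he]⟩

/-- Two surjections from finite free modules of equal rank onto the same projective module, over
a principal ideal domain, differ by an isomorphism of their sources. -/
theorem LinearMap.exists_equiv_comp_eq_of_surjective {R M₁ M₂ P : Type*} [CommRing R] [IsDomain R]
    [IsPrincipalIdealRing R] [AddCommGroup M₁] [Module R M₁] [AddCommGroup M₂] [Module R M₂]
    [AddCommGroup P] [Module R P] [Module.Projective R P]
    [Module.Free R M₁] [Module.Free R M₂] [Module.Finite R M₁] [Module.Finite R M₂]
    (hrank : Module.finrank R M₁ = Module.finrank R M₂)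
    (p₁ : M₁ →ₗ[R] P) (p₂ : M₂ →ₗ[R] P)
    (hp₁ : Function.Surjective p₁) (hp₂ : Function.Surjective p₂) :
    ∃ g : M₁ ≃ₗ[R] M₂, ∀ x, p₂ (g x) = p₁ x := by
  obtain ⟨e₁, he₁⟩ := p₁.exists_equiv_ker_prod_of_surjective hp₁
  obtain ⟨e₂, he₂⟩ := p₂.exists_equiv_ker_prod_of_surjective hp₂
  have hker : Module.finrank R p₁.ker = Module.finrank R p₂.ker := by
    have : Module.Finite R P := .of_surjective p₁ hp₁
    have h₁ := e₁.finrank_eq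
    have h₂ := e₂.finrank_eq
    rw [Module.finrank_prod] at h₁ h₂
    omega
  refine ⟨e₁ ≪≫ₗ (LinearEquiv.ofFinrankEq _ _ hker).prodCongr (.refl R P) ≪≫ₗ e₂.symm,
    fun x => ?_⟩
  simp [← he₁, ← he₂]

theorem exists_addEquiv_compatible_with_real_homs
    (G₁ G₂ : Type*) [AddCommGroup G₁] [AddCommGroup G₂]
    [Module.Free ℤ G₁] [Module.Free ℤ G₂]
    [Module.Finite ℤ G₁] [Module.Finite ℤ G₂]
    (hrank : Module.finrank ℤ G₁ = Module.finrank ℤ G₂)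
    (f₁ : G₁ →+ ℝ) (f₂ : G₂ →+ ℝ) (hrange : f₁.range = f₂.range) :
    ∃ g : G₁ ≃+ G₂, ∀ x : G₁, f₂ (g x) = f₁ x := by
  have hmem : ∀ x, f₂.toIntLinearMap x ∈ f₁.toIntLinearMap.range := fun x => by
    have h : f₂ x ∈ f₁.range := hrange ▸ ⟨x, rfl⟩
    exact h
  have hsurj : Function.Surjective (f₂.toIntLinearMap.codRestrict _ hmem) := by
    rintro ⟨y, hy⟩
    have h : y ∈ f₂.range := hrange ▸ hy
    obtain ⟨x, rfl⟩ := h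
    exact ⟨x, rfl⟩
  obtain ⟨g, hg⟩ := LinearMap.exists_equiv_comp_eq_of_surjective hrank
    f₁.toIntLinearMap.rangeRestrict _ f₁.toIntLinearMap.surjective_rangeRestrict hsurj
  exact ⟨g.toAddEquiv, fun x => congrArg Subtype.val (hg x)⟩
end

section
/- Let β, γ ∈ ℝ be such that 1, β, γ are linearly independent over ℚ, and define group homomorphisms f₁, f₂ : ℤ⁴ → ℝ by f₁(n) = n₁ + (2/5)n₂ + βn₃ + γn₄ and f₂(n) = n₁ + (1/5)n₂ + βn₃ + γn₄. Then there is no group isomorphism g : ℤ⁴ → ℤ⁴ such that f₂ ∘ g = f₁ and g(1, 0, 0, 0) = (1, 0, 0, 0). -/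
theorem no_isomorphism_intertwining_f1_f2 (β γ : ℝ)
    (hindep : ∀ a b c : ℚ, (a : ℝ) + (b : ℝ) * β + (c : ℝ) * γ = 0 →
      a = 0 ∧ b = 0 ∧ c = 0) :
    ¬ ∃ g : (Fin 4 → ℤ) ≃+ (Fin 4 → ℤ),
        (∀ n : Fin 4 → ℤ,
          ((g n) 0 : ℝ) + (1 / 5 : ℝ) * (g n) 1 + β * (g n) 2 + γ * (g n) 3
            = (n 0 : ℝ) + (2 / 5 : ℝ) * n 1 + β * n 2 + γ * n 3) ∧
        g ![1, 0, 0, 0] = ![1, 0, 0, 0] := by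
  rintro ⟨g, hg, hfix⟩
  set v := g ![0, 1, 0, 0] with hv
  set w := g.symm ![0, 1, 0, 0] with hw
  have hgw : g w = ![0, 1, 0, 0] := g.apply_symm_apply _
  have hv_eq := hg ![0, 1, 0, 0]
  have hw_eq := hg w
  rw [← hv] at hv_eq
  rw [hgw] at hw_eq
  simp at hv_eq hw_eq
  obtain ⟨hv01, -, -⟩ := hindep (v 0 + 1 / 5 * v 1 - 2 / 5) (v 2) (v 3) (by
    push_cast; linarith)
  obtain ⟨-, hw2, hw3⟩ := hindep (w 0 + 2 / 5 * w 1 - 1 / 5) (w 2) (w 3) (by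
    push_cast; linarith)
  have hv1 : 5 * v 0 + v 1 = 2 := by
    have h : (5 * v 0 + v 1 : ℚ) = 2 := by linarith
    exact_mod_cast h
  have hw_decomp : w = w 0 • ![1, 0, 0, 0] + w 1 • ![0, 1, 0, 0] := by
    ext i
    fin_cases i
    · simp
    · simp
    · simpa using hw2
    · simpa using hw3
  have hmul : w 1 * v 1 = 1 := by
    have h := congrFun hgw 1
    rw [hw_decomp, map_add, map_zsmul, map_zsmul, hfix, ← hv] at h
    simpa using h
  rcases Int.isUnit_iff.mp (IsUnit.of_mul_eq_one_right _ hmul) with h | h <;> omega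
end
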